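/- arXiv:1502.01216 — 2 statements merged into one kernel-verified Lean document; each statement's English description precedes it below -/
import Mathlib

section
/- Let ⟨μ,d⟩ be a generating tuple with degree-monotone weights. If H ∈ ℛℋ(μ,d) is a directed Huffman tree and T ∈ ℛ(μ,d) is a directed tree with f(T) = f(H), then T ∈ ℛℋ(μ,d); that is, a directed tree with the same vector of subordinate groups' weights as some Huffman tree is itself a Huffman tree. -/
open scoped Classical
noncomputable section

/-- A directed tree on a finite vertex set `V`: each vertex has an outbound arc to its
`parent`, the `root` is a fixed point of `parent` (i.e. has no genuine outbound arc), and
every vertex reaches the root by iterating `parent`. -/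
structure DirTree (V : Type) [Fintype V] [DecidableEq V] where
  root : V
  parent : V → V
  parent_root : parent root = root
  reaches : ∀ v, ∃ n, parent^[n] v = root

variable {V : Type} [Fintype V] [DecidableEq V]

namespace DirTree

/-- `u` belongs to the subordinate group of `v`: there is a directed path from `u` to `v`. -/
def Desc (T : DirTree V) (u v : V) : Prop := ∃ n, T.parent^[n] u = v

/-- The set of vertices with an arc to `v`. -/
def children (T : DirTree V) (v : V) : Finset V :=
  Finset.univ.filter fun u => T.parent u = v ∧ u ≠ v

/-- Weight `f_T(v)` of the subordinate group of `v`. -/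
def f (T : DirTree V) (μ : V → ℝ) (v : V) : ℝ :=
  ∑ u ∈ Finset.univ.filter (fun u => T.Desc u v), μ u

/-- Degree of `v` in the underlying undirected tree. -/
def deg (T : DirTree V) (v : V) : ℕ :=
  (T.children v).card + (if v = T.root then 0 else 1)

/-- The underlying undirected tree. -/
def toGraph (T : DirTree V) : SimpleGraph V :=
  SimpleGraph.fromRel fun u v => T.parent u = v ∧ u ≠ v

/-- The vector (as a multiset, i.e. up to ascending rearrangement) of subordinate
groups' weights of internal non-root vertices. -/
def fvec (T : DirTree V) (μ : V → ℝ) : Multiset ℝ :=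
  (Finset.univ.filter fun m => 1 < T.deg m ∧ m ≠ T.root).val.map (T.f μ)

end DirTree

/-- Degree of a vertex in a simple graph. -/
def gdeg (G : SimpleGraph V) (v : V) : ℕ :=
  (Finset.univ.filter fun u => G.Adj v u).card

/-- `⟨μ, d⟩` is a generating tuple: nonnegative weights, degrees at least 1 summing to
`2(|V|-1)`, at least two pendent and at least one internal vertex. -/
structure IsGenTuple (μ : V → ℝ) (d : V → ℕ) : Prop where
  nonneg : ∀ v, 0 ≤ μ v
  deg_pos : ∀ v, 1 ≤ d v
  sum_deg : ∑ v, d v = 2 * (Fintype.card V - 1)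
  two_le_pendent : 2 ≤ (Finset.univ.filter fun v => d v = 1).card
  one_le_internal : 1 ≤ (Finset.univ.filter fun v => 1 < d v).card

/-- Weights are degree-monotone in `⟨μ, d⟩`. -/
def DegMonotone (μ : V → ℝ) (d : V → ℕ) : Prop :=
  (∀ m m', 1 < d m → 1 < d m' → d m < d m' → μ m ≤ μ m') ∧
  ∀ v, d v = 1 → 0 < μ v

/-- `T ∈ ℛ(μ,d)`: directed tree with internal root whose (undirected) degrees match `d`. -/
def memR (T : DirTree V) (d : V → ℕ) : Prop :=
  1 < d T.root ∧ ∀ v, T.deg v = d v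

/-- `G ∈ 𝒯(μ,d)`: `G` is a tree whose degrees match `d`. -/
def memT (G : SimpleGraph V) (d : V → ℕ) : Prop :=
  G.IsTree ∧ ∀ v, gdeg G v = d v

/-- Vertex-weighted Wiener index. -/
def VWWI (μ : V → ℝ) (G : SimpleGraph V) : ℝ :=
  (1 / 2) * ∑ u, ∑ v, μ u * μ v * (G.dist u v : ℝ)

/-- `S = (m, L)` is a minimal star for the state `(U, μ, d)`: the center `m` is an
internal vertex of `U` of least degree among internal vertices of least weight, and the
`d m - 1` leaves `L` are pendent vertices of `U` of least weights. -/
def IsMinimalStar (U : Finset V) (μ : V → ℝ) (d : V → ℕ) (m : V) (L : Finset V) : Prop :=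
  m ∈ U ∧ 1 < d m ∧ L ⊆ U ∧ m ∉ L ∧ L.card = d m - 1 ∧
  (∀ v ∈ L, d v = 1) ∧
  (∀ m' ∈ U, 1 < d m' → μ m ≤ μ m') ∧
  (∀ m' ∈ U, 1 < d m' → μ m' = μ m → d m ≤ d m') ∧
  ∀ u ∈ L, ∀ w ∈ U, d w = 1 → w ∉ L → μ u ≤ μ w

/-- Centers used before step `i` (0-indexed). -/
def usedCenters {q : ℕ} (c : Fin q → V) (i : ℕ) : Finset V :=
  (Finset.univ.filter fun j : Fin q => (j : ℕ) < i).image c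

/-- Vertex set `V_{i+1}` of the state of the Huffman algorithm before (0-indexed) step `i`,
for the candidate Huffman tree `T` with star centers `c`. -/
def stateV (T : DirTree V) {q : ℕ} (c : Fin q → V) (i : ℕ) : Finset V :=
  Finset.univ \ (Finset.univ.filter fun j : Fin q => (j : ℕ) < i).biUnion fun j => T.children (c j)

/-- Weight function `μ^{i+1}` of the state before (0-indexed) step `i`. -/
def stateMu (T : DirTree V) (μ : V → ℝ) {q : ℕ} (c : Fin q → V) (i : ℕ) : V → ℝ :=
  fun v => if v ∈ usedCenters c i then T.f μ v else μ v

/-- Degree function `d^{i+1}` of the state before (0-indexed) step `i`. -/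
def stateD (d : V → ℕ) {q : ℕ} (c : Fin q → V) (i : ℕ) : V → ℕ :=
  fun v => if v ∈ usedCenters c i then 1 else d v

/-- `T` is a directed Huffman tree for `⟨μ, d⟩` whose star sequence has centers
`c 0, …, c (q-1)` (so `S_i` has leaf set `children (c i)`): the centers enumerate the
internal vertices, the root is the last center, and at each of the first `q - 1` steps
the corresponding star is a minimal star of the current state. -/
def IsHuffmanSeq (μ : V → ℝ) (d : V → ℕ) (T : DirTree V) {q : ℕ} (c : Fin q → V) : Prop :=
  (∀ v, T.deg v = d v) ∧
  Function.Injective c ∧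
  (∀ v, 1 < d v ↔ ∃ j, c j = v) ∧
  (∀ hq : 0 < q, T.root = c ⟨q - 1, Nat.sub_lt hq Nat.one_pos⟩) ∧
  ∀ i : Fin q, (i : ℕ) < q - 1 →
    IsMinimalStar (stateV T c (i : ℕ)) (stateMu T μ c (i : ℕ)) (stateD d c (i : ℕ))
      (c i) (T.children (c i))

/-- `T ∈ ℛℋ(μ,d)`: `T` is a directed Huffman tree for `⟨μ, d⟩`. -/
def IsHuffmanDir (μ : V → ℝ) (d : V → ℕ) (T : DirTree V) : Prop :=
  ∃ (q : ℕ) (c : Fin q → V), IsHuffmanSeq μ d T c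

/-- Sum of the `k` smallest components of a multiset of reals. -/
def ascSum (s : Multiset ℝ) (k : ℕ) : ℝ := ((s.sort (· ≤ ·)).take k).sum

/-- `x` weakly majorizes `y` (`y ⪯^w x`). -/
def WMaj (x y : Multiset ℝ) : Prop :=
  Multiset.card x = Multiset.card y ∧ ∀ k, ascSum x k ≤ ascSum y k

/-- `x` strictly weakly majorizes `y` (`y ≺^w x`). -/
def SWMaj (x y : Multiset ℝ) : Prop := WMaj x y ∧ x ≠ y

/-- A subfamily of least elements is the unique subfamily of at least its size and at most
its sum, provided all elements are positive. -/
lemma Multiset.eq_of_sum_le_of_least {K L R R' : Multiset ℝ} (h : R' + K = R + L)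
    (hpos : ∀ x ∈ R + L, 0 < x) (hle : ∀ x ∈ L, ∀ y ∈ R, x ≤ y)
    (hcard : Multiset.card L ≤ Multiset.card K) (hsum : K.sum ≤ L.sum) : K = L := by
  have hKR : ∀ y ∈ K - L, y ∈ R := by
    intro y hy
    have h1 := congrArg (Multiset.count y) h
    rw [← Multiset.count_pos] at hy ⊢
    simp only [Multiset.count_add, Multiset.count_sub] at h1 hy
    omega
  have hLL : ∀ x ∈ L - K, x ∈ L := fun x hx => Multiset.mem_of_le tsub_le_self hx
  have hK : K - L + (K ∩ L) = K := Multiset.sub_add_inter K L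
  have hL : L - K + (K ∩ L) = L := by rw [Multiset.inter_comm]; exact Multiset.sub_add_inter L K
  obtain ⟨t, ht0, htL, htK⟩ :
      ∃ t : ℝ, 0 ≤ t ∧ (∀ x ∈ L - K, x ≤ t) ∧ ∀ y ∈ K - L, t < y := by
    by_cases h0 : L - K = 0
    · refine ⟨0, le_rfl, by simp [h0], fun y hy => hpos y ?_⟩
      exact Multiset.mem_add.2 (Or.inl (hKR y hy))
    · obtain ⟨t, ht, hmax⟩ := (L - K).toFinset.exists_max_image id
        (by simpa [Multiset.toFinset_nonempty] using h0)
      rw [Multiset.mem_toFinset] at ht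
      refine ⟨t, (hpos t (Multiset.mem_add.2 (Or.inr (hLL t ht)))).le,
        fun x hx => hmax x (Multiset.mem_toFinset.2 hx), fun y hy => ?_⟩
      refine lt_of_le_of_ne (hle t (hLL t ht) y (hKR y hy)) ?_
      rintro rfl
      rw [← Multiset.count_pos, Multiset.count_sub] at ht hy
      omega
  have hsum' : (K - L).sum ≤ (L - K).sum := by
    have h1 := congrArg Multiset.sum hK
    have h2 := congrArg Multiset.sum hL
    rw [Multiset.sum_add] at h1 h2
    linarith
  have hcard' : Multiset.card (L - K) ≤ Multiset.card (K - L) := by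
    have h1 := congrArg Multiset.card hK
    have h2 := congrArg Multiset.card hL
    rw [Multiset.card_add] at h1 h2
    omega
  have hLt : (L - K).sum ≤ Multiset.card (L - K) • t := Multiset.sum_le_card_nsmul _ _ htL
  have hmid : Multiset.card (L - K) • t ≤ Multiset.card (K - L) • t :=
    nsmul_le_nsmul_left ht0 hcard'
  have hKL0 : K - L = 0 := by
    by_contra h0
    have hlt : ((K - L).map fun _ => t).sum < ((K - L).map id).sum :=
      Multiset.sum_lt_sum_of_nonempty h0 htK
    rw [Multiset.map_id, Multiset.map_const', Multiset.sum_replicate] at hlt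
    linarith
  have hLK0 : L - K = 0 := by
    rw [← Multiset.card_eq_zero]
    simpa [hKL0] using hcard'
  exact le_antisymm (tsub_eq_zero_iff_le.1 hKL0) (tsub_eq_zero_iff_le.1 hLK0)

lemma Finset.map_val_sdiff_insert {α β : Type*} [DecidableEq α] {S A : Finset α} {m : α}
    (g : α → β) (hm : m ∈ S) (hA : m ∉ A) :
    (S \ A).val.map g = g m ::ₘ (S \ insert m A).val.map g := by
  have : S \ A = insert m (S \ insert m A) := by
    ext v
    by_cases h : v = m
    · subst h; simp [hm, hA]
    · simp [h]
  rw [this, Finset.insert_val_of_notMem (by simp), Multiset.map_cons]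

namespace DirTree

variable (X : DirTree V)

/-- Number of arcs on the directed path from `v` to the root. -/
def depth (v : V) : ℕ := Nat.find (X.reaches v)

lemma parent_iterate_depth (v : V) : X.parent^[X.depth v] v = X.root := Nat.find_spec (X.reaches v)

lemma parent_iterate_root (n : ℕ) : X.parent^[n] X.root = X.root :=
  Function.iterate_fixed X.parent_root n

lemma depth_parent (v : V) : X.depth (X.parent v) = X.depth v - 1 := by
  refine le_antisymm (Nat.find_min' _ ?_) ?_
  · rcases Nat.eq_zero_or_pos (X.depth v) with h | h
    · have := X.parent_iterate_depth v
      rw [h] at this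
      simp only [Function.iterate_zero, id] at this
      simp [this, X.parent_root, parent_iterate_root]
    · rw [← Function.iterate_succ_apply, Nat.succ_eq_add_one, Nat.sub_add_cancel h]
      exact X.parent_iterate_depth v
  · have : X.depth v ≤ X.depth (X.parent v) + 1 := Nat.find_min' _ (by
      rw [Function.iterate_succ_apply]
      exact X.parent_iterate_depth _)
    omega

lemma depth_iterate (n : ℕ) (v : V) : X.depth (X.parent^[n] v) = X.depth v - n := by
  induction n with
  | zero => rfl
  | succ n ih => rw [Function.iterate_succ_apply', depth_parent, ih]; omega

variable {X}

lemma mem_children {u v : V} : u ∈ X.children v ↔ X.parent u = v ∧ u ≠ v := by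
  simp [children]

lemma ne_root_of_mem_children {u v : V} (h : u ∈ X.children v) : u ≠ X.root := by
  rintro rfl
  rw [mem_children, X.parent_root] at h
  exact h.2 h.1

lemma depth_pos {v : V} (h : v ≠ X.root) : 0 < X.depth v := by
  rw [Nat.pos_iff_ne_zero]
  intro h0
  have := X.parent_iterate_depth v
  rw [h0] at this
  exact h this

lemma depth_child {u v : V} (h : u ∈ X.children v) : X.depth u = X.depth v + 1 := by
  have h1 := depth_pos (ne_root_of_mem_children h)
  have h2 := X.depth_parent u
  rw [(mem_children.1 h).1] at h2
  omega

lemma Desc.trans {u v w : V} (h : X.Desc u v) (h' : X.Desc v w) : X.Desc u w := by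
  obtain ⟨n, rfl⟩ := h
  obtain ⟨k, rfl⟩ := h'
  exact ⟨k + n, Function.iterate_add_apply _ _ _ _⟩

lemma desc_refl (v : V) : X.Desc v v := ⟨0, rfl⟩

lemma desc_of_mem_children {u v : V} (h : u ∈ X.children v) : X.Desc u v :=
  ⟨1, (mem_children.1 h).1⟩

lemma eq_root_of_desc {v : V} (h : X.Desc X.root v) : v = X.root := by
  obtain ⟨n, rfl⟩ := h
  exact X.parent_iterate_root n

lemma Desc.depth_le {u v : V} (h : X.Desc u v) : X.depth v ≤ X.depth u := by
  obtain ⟨n, rfl⟩ := h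
  rw [depth_iterate]
  omega

lemma desc_iff {u v : V} : X.Desc u v ↔ u = v ∨ ∃ w ∈ X.children v, X.Desc u w := by
  constructor
  · rintro ⟨n, hn⟩
    induction n with
    | zero => exact Or.inl hn
    | succ n ih =>
      rw [Function.iterate_succ_apply'] at hn
      by_cases hv : X.parent^[n] u = v
      · exact ih hv
      · exact Or.inr ⟨_, mem_children.2 ⟨hn, hv⟩, n, rfl⟩
  · rintro (rfl | ⟨w, hw, h⟩)
    · exact desc_refl _
    · exact h.trans (desc_of_mem_children hw)

lemma child_unique {u v w w' : V} (hw : w ∈ X.children v) (hw' : w' ∈ X.children v)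
    (h : X.Desc u w) (h' : X.Desc u w') : w = w' := by
  have e := depth_child hw
  have e' := depth_child hw'
  obtain ⟨n, rfl⟩ := h
  obtain ⟨k, rfl⟩ := h'
  rw [depth_iterate] at e e'
  have : n = k := by omega
  rw [this]

lemma f_eq (μ : V → ℝ) (v : V) : X.f μ v = μ v + ∑ w ∈ X.children v, X.f μ w := by
  have hset : Finset.univ.filter (fun u => X.Desc u v) =
      insert v ((X.children v).biUnion fun w => Finset.univ.filter fun u => X.Desc u w) := by
    ext u
    simp [desc_iff (v := v)]
  unfold f
  rw [hset, Finset.sum_insert, Finset.sum_biUnion]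
  · intro w hw w' hw' hne
    rw [Function.onFun, Finset.disjoint_left]
    intro u hu hu'
    simp only [Finset.mem_filter, Finset.mem_univ, true_and] at hu hu'
    exact hne (child_unique hw hw' hu hu')
  · simp only [Finset.mem_biUnion, Finset.mem_filter, Finset.mem_univ, true_and, not_exists,
      not_and]
    intro w hw h
    have h1 := depth_child hw
    have h2 := h.depth_le
    omega

lemma Desc.f_le {μ : V → ℝ} (hμ : ∀ v, 0 ≤ μ v) {u v : V} (h : X.Desc u v) :
    X.f μ u ≤ X.f μ v := by
  refine Finset.sum_le_sum_of_subset_of_nonneg ?_ fun i _ _ => hμ i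
  intro w hw
  simp only [Finset.mem_filter, Finset.mem_univ, true_and] at hw ⊢
  exact hw.trans h

lemma card_children {v : V} (h : v ≠ X.root) : (X.children v).card = X.deg v - 1 := by
  simp [deg, h]

lemma f_of_pendent (μ : V → ℝ) {v : V} (h : v ≠ X.root) (hd : X.deg v = 1) : X.f μ v = μ v := by
  have : X.children v = ∅ := by rw [← Finset.card_eq_zero, card_children h, hd]
  rw [f_eq, this, Finset.sum_empty, add_zero]

variable (X) in
/-- Every child of a vertex in `A` is pendent or itself in `A`. -/
def ChildClosed (d : V → ℕ) (A : Finset V) : Prop :=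
  ∀ x ∈ A, ∀ w ∈ X.children x, d w = 1 ∨ w ∈ A

variable (X) in
/-- The pendent vertices left after contracting the stars with centers in `A`. -/
def pendents (d : V → ℕ) (A : Finset V) : Finset V :=
  Finset.univ.filter fun v => (d v = 1 ∨ v ∈ A) ∧ ∀ x ∈ A, v ∉ X.children x

lemma mem_pendents {d : V → ℕ} {A : Finset V} {v : V} :
    v ∈ X.pendents d A ↔ (d v = 1 ∨ v ∈ A) ∧ ∀ x ∈ A, v ∉ X.children x := by
  simp [pendents]

variable (X) in
/-- The star formed by `m` and its children is minimal after contracting the stars with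
centers in `A`. -/
structure StarMinimal (μ : V → ℝ) (d : V → ℕ) (A : Finset V) (m : V) : Prop where
  notMem : m ∉ A
  internal : 1 < d m
  children_pendent : ∀ w ∈ X.children m, d w = 1 ∨ w ∈ A
  weight_le : ∀ m' ∉ A, 1 < d m' → μ m ≤ μ m'
  degree_le : ∀ m' ∉ A, 1 < d m' → μ m' = μ m → d m ≤ d m'
  least : ∀ u ∈ X.children m, ∀ w ∈ X.pendents d A, w ∉ X.children m → X.f μ u ≤ X.f μ w

variable {μ : V → ℝ} {d : V → ℕ} {A : Finset V} {m : V}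

lemma ChildClosed.notMem_children (h : X.ChildClosed d A) (hm : m ∉ A) (hd : 1 < d m) :
    ∀ x ∈ A, m ∉ X.children x := by
  intro x hx hmx
  rcases h x hx m hmx with h1 | h1
  · omega
  · exact hm h1

lemma StarMinimal.childClosed_insert (hs : X.StarMinimal μ d A m) (h : X.ChildClosed d A) :
    X.ChildClosed d (insert m A) := by
  intro x hx w hw
  rw [Finset.mem_insert] at hx ⊢
  rcases hx with rfl | hx
  · exact (hs.children_pendent w hw).imp_right Or.inr
  · exact (h x hx w hw).imp_right Or.inr

lemma children_subset_pendents (hm : m ∉ A) (hc : ∀ w ∈ X.children m, d w = 1 ∨ w ∈ A) :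
    X.children m ⊆ X.pendents d A := by
  intro w hw
  refine mem_pendents.2 ⟨hc w hw, fun x hx hwx => hm ?_⟩
  rw [mem_children] at hw hwx
  rwa [← hw.1, hwx.1]

lemma map_pendents (hsub : X.children m ⊆ X.pendents d A) :
    (X.pendents d A).val.map (X.f μ) =
      (X.pendents d A \ X.children m).val.map (X.f μ) + (X.children m).val.map (X.f μ) := by
  rw [← Multiset.map_add, Finset.sdiff_val, tsub_add_cancel_of_le (Finset.val_le_iff.2 hsub)]

lemma map_pendents_insert (h : X.ChildClosed d A) (hm : m ∉ A) (hd : 1 < d m) :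
    (X.pendents d (insert m A)).val.map (X.f μ) =
      X.f μ m ::ₘ (X.pendents d A \ X.children m).val.map (X.f μ) := by
  have hset : X.pendents d (insert m A) = insert m (X.pendents d A \ X.children m) := by
    ext v
    have hmm : m ∉ X.children m := fun h => (mem_children.1 h).2 rfl
    have hA := h.notMem_children hm hd
    simp only [mem_pendents, Finset.mem_insert, Finset.mem_sdiff, forall_eq_or_imp]
    constructor
    · rintro ⟨h1, h2, h3⟩
      tauto
    · rintro (rfl | ⟨⟨h1, h2⟩, h3⟩)
      · exact ⟨Or.inr (Or.inl rfl), hmm, hA⟩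
      · tauto
  have hnot : m ∉ X.pendents d A \ X.children m := by
    rw [Finset.mem_sdiff, mem_pendents]
    rintro ⟨⟨h1 | h1, -⟩, -⟩
    · omega
    · exact hm h1
  rw [hset, Finset.insert_val_of_notMem hnot, Multiset.map_cons]

lemma mem_stateV {q : ℕ} {c : Fin q → V} {i : ℕ} {v : V} :
    v ∈ stateV X c i ↔ ∀ x ∈ usedCenters c i, v ∉ X.children x := by
  simp [stateV, usedCenters]

lemma isMinimalStar_iff {q : ℕ} {c : Fin q → V} {i : ℕ} (hdeg : ∀ v, X.deg v = d v)
    (hpend : ∀ v, d v = 1 → X.f μ v = μ v) (hmroot : m ≠ X.root)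
    (hcl : X.ChildClosed d (usedCenters c i)) :
    IsMinimalStar (stateV X c i) (stateMu X μ c i) (stateD d c i) m (X.children m) ↔
      X.StarMinimal μ d (usedCenters c i) m := by
  set A := usedCenters c i with hA
  have hD1 : ∀ v, stateD d c i v = 1 ↔ d v = 1 ∨ v ∈ A := by
    intro v
    unfold stateD
    split_ifs with h <;> simp [h, hA]
  have hD2 : ∀ v, 1 < stateD d c i v ↔ 1 < d v ∧ v ∉ A := by
    intro v
    unfold stateD
    split_ifs with h <;> simp [h, hA]
  have hDn : ∀ v, v ∉ A → stateD d c i v = d v := fun v h => if_neg h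
  have hMn : ∀ v, v ∉ A → stateMu X μ c i v = μ v := fun v h => if_neg h
  have hMp : ∀ v, (d v = 1 ∨ v ∈ A) → stateMu X μ c i v = X.f μ v := by
    intro v hv
    unfold stateMu
    split_ifs with h
    · rfl
    · exact (hpend v (hv.resolve_right h)).symm
  constructor
  · rintro ⟨-, h2, h3, -, -, h6, h7, h8, h9⟩
    rw [hD2] at h2
    refine ⟨h2.2, h2.1, fun w hw => (hD1 w).1 (h6 w hw), ?_, ?_, ?_⟩
    · intro m' hm' hd'
      have := h7 m' (mem_stateV.2 (hcl.notMem_children hm' hd')) ((hD2 m').2 ⟨hd', hm'⟩)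
      rwa [hMn _ h2.2, hMn _ hm'] at this
    · intro m' hm' hd'
      have := h8 m' (mem_stateV.2 (hcl.notMem_children hm' hd')) ((hD2 m').2 ⟨hd', hm'⟩)
      rwa [hMn _ h2.2, hMn _ hm', hDn _ h2.2, hDn _ hm'] at this
    · intro u hu w hw hwn
      rw [mem_pendents] at hw
      have := h9 u hu w (mem_stateV.2 hw.2) ((hD1 w).2 hw.1) hwn
      rwa [hMp u ((hD1 u).1 (h6 u hu)), hMp w hw.1] at this
  · intro hs
    have hsub := children_subset_pendents hs.notMem hs.children_pendent
    refine ⟨mem_stateV.2 (hcl.notMem_children hs.notMem hs.internal),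
      (hD2 m).2 ⟨hs.internal, hs.notMem⟩,
      fun w hw => mem_stateV.2 (mem_pendents.1 (hsub hw)).2,
      fun h => (mem_children.1 h).2 rfl, ?_,
      fun w hw => (hD1 w).2 (hs.children_pendent w hw), ?_, ?_, ?_⟩
    · rw [card_children hmroot, hdeg, hDn _ hs.notMem]
    · intro m' _ hd'
      rw [hD2] at hd'
      rw [hMn _ hs.notMem, hMn _ hd'.2]
      exact hs.weight_le m' hd'.2 hd'.1
    · intro m' _ hd'
      rw [hD2] at hd'
      rw [hMn _ hs.notMem, hMn _ hd'.2, hDn _ hs.notMem, hDn _ hd'.2]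
      exact hs.degree_le m' hd'.2 hd'.1
    · intro u hu w hw hdw hwn
      rw [hD1] at hdw
      rw [hMp u (hs.children_pendent u hu), hMp w hdw]
      exact hs.least u hu w (mem_pendents.2 ⟨hdw, mem_stateV.1 hw⟩) hwn

/-- The trees obtained from `T` and `H` by contracting the stars with centers in `A` and `B`
have matching weights, degrees and vectors of subordinate groups' weights. -/
structure Matching (μ : V → ℝ) (d : V → ℕ) (T H : DirTree V) (A B : Finset V) : Prop where
  rootT : T.root ∉ A
  rootH : H.root ∉ B
  closedT : T.ChildClosed d A
  closedH : H.ChildClosed d B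
  pend : (T.pendents d A).val.map (T.f μ) = (H.pendents d B).val.map (H.f μ)
  pos : ∀ x ∈ (H.pendents d B).val.map (H.f μ), 0 < x
  inner : ((Finset.univ.filter fun v => 1 < d v) \ A).val.map (fun v => (μ v, d v)) =
    ((Finset.univ.filter fun v => 1 < d v) \ B).val.map (fun v => (μ v, d v))
  fvec : (((Finset.univ.filter fun v => 1 < d v).erase T.root) \ A).val.map (T.f μ) =
    (((Finset.univ.filter fun v => 1 < d v).erase H.root) \ B).val.map (H.f μ)

lemma Matching.exists_star {T H : DirTree V} {A B : Finset V} (hμ : ∀ v, 0 ≤ μ v)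
    (hmono : ∀ m m', 1 < d m → 1 < d m' → d m < d m' → μ m ≤ μ m')
    (hT : ∀ v, T.deg v = d v) (hH : ∀ v, H.deg v = d v)
    (hM : Matching μ d T H A B) {b : V} (hb : H.StarMinimal μ d B b) (hbr : b ≠ H.root) :
    ∃ a, a ≠ T.root ∧ T.StarMinimal μ d A a ∧ Matching μ d T H (insert a A) (insert b B) := by
  set I : Finset V := Finset.univ.filter fun v => 1 < d v with hI
  have memI : ∀ v, v ∈ I ↔ 1 < d v := by simp [hI]
  have matchI : ∀ m, 1 < d m → m ∉ A → ∃ m', 1 < d m' ∧ m' ∉ B ∧ μ m' = μ m ∧ d m' = d m := by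
    intro m hm hmA
    have h1 : (μ m, d m) ∈ (I \ A).val.map (fun v => (μ v, d v)) :=
      Multiset.mem_map_of_mem _ (Finset.mem_sdiff.2 ⟨(memI m).2 hm, hmA⟩)
    rw [hM.inner, Multiset.mem_map] at h1
    obtain ⟨m', hm', he⟩ := h1
    rw [Finset.mem_val, Finset.mem_sdiff, memI] at hm'
    rw [Prod.mk.injEq] at he
    exact ⟨m', hm'.1, hm'.2, he.1, he.2⟩
  obtain ⟨m₀, hm₀, hfm₀⟩ : ∃ m₀, m₀ ∈ (I.erase T.root) \ A ∧ T.f μ m₀ = H.f μ b := by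
    have h1 : H.f μ b ∈ ((I.erase H.root) \ B).val.map (H.f μ) :=
      Multiset.mem_map_of_mem _ (Finset.mem_sdiff.2
        ⟨Finset.mem_erase.2 ⟨hbr, (memI b).2 hb.internal⟩, hb.notMem⟩)
    rw [← hM.fvec, Multiset.mem_map] at h1
    exact h1
  rw [Finset.mem_sdiff, Finset.mem_erase, memI] at hm₀
  obtain ⟨a, ha, hamax⟩ := ((I \ A).filter fun v => T.Desc v m₀).exists_max_image T.depth
    ⟨m₀, by simp [memI, hm₀, desc_refl]⟩
  simp only [Finset.mem_filter, Finset.mem_sdiff, memI] at ha hamax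
  obtain ⟨⟨had, haA⟩, hadesc⟩ := ha
  have har : a ≠ T.root := by
    rintro rfl
    exact hm₀.1.1 (eq_root_of_desc hadesc)
  have hac : ∀ w ∈ T.children a, d w = 1 ∨ w ∈ A := by
    intro w hw
    by_contra! hcon
    have hdw : 1 < d w := by
      have h1 : 0 < T.deg w := by simp [deg, ne_root_of_mem_children hw]
      rw [hT] at h1
      omega
    have h1 := hamax w ⟨⟨hdw, hcon.2⟩, (desc_of_mem_children hw).trans hadesc⟩
    have h2 := depth_child hw
    omega
  have hTsub := children_subset_pendents haA hac
  have hHsub := children_subset_pendents hb.notMem hb.children_pendent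
  have hTp := map_pendents (μ := μ) hTsub
  have hHp := map_pendents (μ := μ) hHsub
  set RT := (T.pendents d A \ T.children a).val.map (T.f μ) with hRT
  set RH := (H.pendents d B \ H.children b).val.map (H.f μ) with hRH
  set K := (T.children a).val.map (T.f μ) with hK
  set L := (H.children b).val.map (H.f μ) with hL
  have hcardK : Multiset.card K = d a - 1 := by
    rw [hK, Multiset.card_map, ← hT, ← card_children har, Finset.card_val]
  have hcardL : Multiset.card L = d b - 1 := by
    rw [hL, Multiset.card_map, ← hH, ← card_children hbr, Finset.card_val]
  have hfa : T.f μ a = μ a + K.sum := f_eq μ a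
  have hfb : H.f μ b = μ b + L.sum := f_eq μ b
  obtain ⟨a', had', haB, hμa, hda⟩ := matchI a had haA
  have hμba : μ b ≤ μ a := hμa ▸ hb.weight_le a' haB had'
  have hdba : d b ≤ d a := by
    rw [← hda]
    by_contra! hlt
    exact absurd (hb.degree_le a' haB had'
      (le_antisymm (hmono a' b had' hb.internal hlt) (hb.weight_le a' haB had'))) (by omega)
  have hfle : T.f μ a ≤ H.f μ b := hfm₀ ▸ hadesc.f_le hμ
  have hpos : ∀ x ∈ RH + L, 0 < x := hHp ▸ hM.pos
  have hleast : ∀ x ∈ L, ∀ y ∈ RH, x ≤ y := by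
    intro x hx y hy
    rw [hL, Multiset.mem_map] at hx
    rw [hRH, Multiset.mem_map] at hy
    obtain ⟨u, hu, rfl⟩ := hx
    obtain ⟨w, hw, rfl⟩ := hy
    rw [Finset.mem_val, Finset.mem_sdiff] at hw
    exact hb.least u hu w hw.1 hw.2
  have hadd : RT + K = RH + L := by rw [← hTp, ← hHp, hM.pend]
  have hKL : K = L :=
    Multiset.eq_of_sum_le_of_least hadd hpos hleast (by omega) (by linarith)
  have hRR : RT = RH := by rw [hKL] at hadd; exact add_right_cancel hadd
  have hdab : d a = d b := by
    rw [hKL, hcardL] at hcardK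
    have := hb.internal
    omega
  have hμab : μ a = μ b := by rw [hKL] at hfa; linarith
  have hfab : T.f μ a = H.f μ b := by rw [hfa, hfb, hKL, hμab]
  have hstar : T.StarMinimal μ d A a := by
    refine ⟨haA, had, hac, ?_, ?_, ?_⟩
    · intro m hm hdm
      obtain ⟨m', h1, h2, h3, -⟩ := matchI m hdm hm
      rw [hμab, ← h3]
      exact hb.weight_le m' h2 h1
    · intro m hm hdm he
      obtain ⟨m', h1, h2, h3, h4⟩ := matchI m hdm hm
      rw [hdab, ← h4]
      exact hb.degree_le m' h2 h1 (by rw [h3, he, hμab])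
    · intro u hu w hw hwn
      refine hleast _ (hKL ▸ Multiset.mem_map_of_mem _ hu) _ (hRR ▸ Multiset.mem_map_of_mem _ ?_)
      exact Finset.mem_sdiff.2 ⟨hw, hwn⟩
  have hpT := map_pendents_insert (μ := μ) hM.closedT haA had
  have hpH := map_pendents_insert (μ := μ) hM.closedH hb.notMem hb.internal
  refine ⟨a, har, hstar, ?_, ?_, hstar.childClosed_insert hM.closedT,
    hb.childClosed_insert hM.closedH, ?_, ?_, ?_, ?_⟩
  · simpa [har.symm] using hM.rootT
  · simpa [hbr.symm] using hM.rootH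
  · rw [hpT, hpH, hfab, ← hRT, ← hRH, hRR]
  · rw [hpH]
    intro x hx
    rcases Multiset.mem_cons.1 hx with rfl | hx
    · obtain ⟨y, hy⟩ : ∃ y, y ∈ L := by
        rw [← Multiset.card_pos_iff_exists_mem, hcardL]
        have := hb.internal
        omega
      have h1 : y ≤ L.sum := Multiset.single_le_sum
        (fun z hz => (hpos z (Multiset.mem_add.2 (Or.inr hz))).le) y hy
      have h2 := hpos y (Multiset.mem_add.2 (Or.inr hy))
      have h3 := hμ b
      rw [hfb]
      linarith
    · exact hpos x (Multiset.mem_add.2 (Or.inl hx))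
  · have h := hM.inner
    rw [Finset.map_val_sdiff_insert _ ((memI a).2 had) haA,
      Finset.map_val_sdiff_insert _ ((memI b).2 hb.internal) hb.notMem, hμab, hdab] at h
    exact (Multiset.cons_inj_right _).1 h
  · have h := hM.fvec
    rw [Finset.map_val_sdiff_insert _ (Finset.mem_erase.2 ⟨har, (memI a).2 had⟩) haA,
      Finset.map_val_sdiff_insert _ (Finset.mem_erase.2 ⟨hbr, (memI b).2 hb.internal⟩) hb.notMem,
      hfab] at h
    exact (Multiset.cons_inj_right _).1 h

lemma Matching.initial {T H : DirTree V} (hT : ∀ v, T.deg v = d v) (hH : ∀ v, H.deg v = d v)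
    (hfT : ∀ v, d v = 1 → T.f μ v = μ v) (hfH : ∀ v, d v = 1 → H.f μ v = μ v)
    (hpos : ∀ v, d v = 1 → 0 < μ v) (hfeq : T.fvec μ = H.fvec μ) : Matching μ d T H ∅ ∅ := by
  have hp : ∀ X : DirTree V, (∀ v, d v = 1 → X.f μ v = μ v) →
      (X.pendents d ∅).val.map (X.f μ) = (Finset.univ.filter fun v => d v = 1).val.map μ := by
    intro X hX
    have : X.pendents d ∅ = Finset.univ.filter fun v => d v = 1 := by
      ext v
      simp [mem_pendents]
    rw [this]
    exact Multiset.map_congr rfl fun v hv => hX v (by simpa using hv)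
  have hf : ∀ X : DirTree V, (∀ v, X.deg v = d v) →
      (((Finset.univ.filter fun v => 1 < d v).erase X.root) \ ∅).val.map (X.f μ) =
        X.fvec μ := by
    intro X hX
    have : ((Finset.univ.filter fun v => 1 < d v).erase X.root) \ ∅ =
        Finset.univ.filter fun m => 1 < X.deg m ∧ m ≠ X.root := by
      ext v
      simp [hX, and_comm]
    rw [this, DirTree.fvec]
  refine ⟨by simp, by simp, by simp [ChildClosed], by simp [ChildClosed], ?_, ?_, rfl, ?_⟩
  · rw [hp T hfT, hp H hfH]
  · rw [hp H hfH]
    intro x hx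
    obtain ⟨v, hv, rfl⟩ := Multiset.mem_map.1 hx
    exact hpos v (by simpa using hv)
  · rw [hf T hT, hf H hH, hfeq]

end DirTree

lemma mem_usedCenters {V : Type} [Fintype V] [DecidableEq V] {q : ℕ} {c : Fin q → V} {i : ℕ}
    {v : V} : v ∈ usedCenters c i ↔ ∃ j : Fin q, (j : ℕ) < i ∧ c j = v := by
  simp [usedCenters]

lemma usedCenters_succ {V : Type} [Fintype V] [DecidableEq V] {q : ℕ} {c : Fin q → V}
    (i : Fin q) : usedCenters c ((i : ℕ) + 1) = insert (c i) (usedCenters c i) := by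
  ext v
  simp only [mem_usedCenters, Finset.mem_insert]
  constructor
  · rintro ⟨j, hj, rfl⟩
    rcases Nat.lt_succ_iff_lt_or_eq.1 hj with h | h
    · exact Or.inr ⟨j, h, rfl⟩
    · exact Or.inl (congrArg c (Fin.ext h))
  · rintro (rfl | ⟨j, hj, rfl⟩)
    · exact ⟨i, Nat.lt_succ_self _, rfl⟩
    · exact ⟨j, hj.trans (Nat.lt_succ_self _), rfl⟩

lemma usedCenters_comp_val {V : Type} [Fintype V] [DecidableEq V] {q : ℕ} (a : ℕ → V) {i : ℕ}
    (hi : i ≤ q) : usedCenters (fun j : Fin q => a j) i = (Finset.range i).image a := by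
  ext v
  simp only [mem_usedCenters, Finset.mem_image, Finset.mem_range]
  constructor
  · rintro ⟨j, hj, rfl⟩
    exact ⟨j, hj, rfl⟩
  · rintro ⟨j, hj, rfl⟩
    exact ⟨⟨j, hj.trans_le hi⟩, hj, rfl⟩

/-- a directed tree in `ℛ(μ,d)` having the same vector of subordinate
groups' weights as some directed Huffman tree is itself a directed Huffman tree. -/
theorem eq_fvec_huffman_isHuffman {V : Type} [Fintype V] [DecidableEq V]
    (μ : V → ℝ) (d : V → ℕ) (hgen : IsGenTuple μ d) (hmono : DegMonotone μ d)
    (H : DirTree V) (hH : IsHuffmanDir μ d H)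
    (T : DirTree V) (hT : memR T d) (hfeq : T.fvec μ = H.fvec μ) :
    IsHuffmanDir μ d T := by
  classical
  obtain ⟨hTroot, hTdeg⟩ := hT
  obtain ⟨q, c, hHdeg, hcinj, hcint, hcroot, hcstar⟩ := hH
  have hq : 0 < q := by
    obtain ⟨j, -⟩ := (hcint _).1 hTroot
    exact j.pos
  have hHroot := hcroot hq
  have hfT : ∀ v, d v = 1 → T.f μ v = μ v := by
    intro v hv
    refine DirTree.f_of_pendent μ ?_ ((hTdeg v).trans hv)
    rintro rfl
    omega
  have hfH : ∀ v, d v = 1 → H.f μ v = μ v := by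
    intro v hv
    refine DirTree.f_of_pendent μ ?_ ((hHdeg v).trans hv)
    intro h
    have := (hcint v).2 ⟨_, (h.trans hHroot).symm⟩
    omega
  have hcne : ∀ i : Fin q, (i : ℕ) < q - 1 → c i ≠ H.root := by
    intro i hi h
    have := congrArg Fin.val (hcinj (h.trans hHroot))
    simp only at this
    omega
  have key : ∀ i ≤ q - 1, ∃ a : ℕ → V,
      DirTree.Matching μ d T H ((Finset.range i).image a) (usedCenters c i) ∧
      ∀ j < i, a j ≠ T.root ∧ T.StarMinimal μ d ((Finset.range j).image a) (a j) ∧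
        T.ChildClosed d ((Finset.range j).image a) := by
    intro i
    induction i with
    | zero =>
      intro _
      refine ⟨fun _ => T.root, ?_, by simp⟩
      have h0 : usedCenters c 0 = ∅ := by simp [usedCenters]
      rw [h0, Finset.range_zero, Finset.image_empty]
      exact DirTree.Matching.initial hTdeg hHdeg hfT hfH hmono.2 hfeq
    | succ i ih =>
      intro hi
      obtain ⟨a, hM, ha⟩ := ih (by omega)
      have hiq : i < q - 1 := by omega
      have hne := hcne ⟨i, by omega⟩ hiq
      have hb := (DirTree.isMinimalStar_iff hHdeg hfH hne hM.closedH).1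
        (hcstar ⟨i, by omega⟩ hiq)
      obtain ⟨x, hxr, hx, hM'⟩ := hM.exists_star hgen.nonneg hmono.1 hTdeg hHdeg hb hne
      have himg : ∀ j ≤ i, (Finset.range j).image (Function.update a i x) =
          (Finset.range j).image a := by
        intro j hj
        refine Finset.image_congr fun k hk => ?_
        have : k ≠ i := by
          have := Finset.mem_range.1 hk
          omega
        exact Function.update_of_ne this _ _
      refine ⟨Function.update a i x, ?_, ?_⟩
      · rw [Finset.range_add_one, Finset.image_insert, himg i le_rfl, Function.update_self,
          usedCenters_succ ⟨i, by omega⟩]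
        exact hM'
      · intro j hj
        rw [himg j (by omega)]
        rcases Nat.lt_succ_iff_lt_or_eq.1 hj with h | rfl
        · rw [Function.update_of_ne h.ne]
          exact ha j h
        · rw [Function.update_self]
          exact ⟨hxr, hx, hM.closedT⟩
  obtain ⟨a₀, -, ha₀⟩ := key (q - 1) le_rfl
  obtain ⟨a, ha, hlast⟩ : ∃ a : ℕ → V, (∀ j < q - 1, a j ≠ T.root ∧
      T.StarMinimal μ d ((Finset.range j).image a) (a j) ∧
      T.ChildClosed d ((Finset.range j).image a)) ∧ a (q - 1) = T.root := by
    refine ⟨Function.update a₀ (q - 1) T.root, ?_, Function.update_self _ _ _⟩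
    intro j hj
    have himg : (Finset.range j).image (Function.update a₀ (q - 1) T.root) =
        (Finset.range j).image a₀ := by
      refine Finset.image_congr fun k hk => ?_
      have : k ≠ q - 1 := by
        have := Finset.mem_range.1 hk
        omega
      exact Function.update_of_ne this _ _
    rw [himg, Function.update_of_ne hj.ne]
    exact ha₀ j hj
  have hne : ∀ j k, j < k → k < q → a j ≠ a k := by
    intro j k hjk hk h
    by_cases hk' : k < q - 1
    · exact (ha k hk').2.1.notMem
        (Finset.mem_image.2 ⟨j, Finset.mem_range.2 hjk, h⟩)
    · have : k = q - 1 := by omega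
      rw [this, hlast] at h
      exact (ha j (by omega)).1 h
  have hinj : Function.Injective fun j : Fin q => a j := by
    intro j k h
    rcases lt_trichotomy (j : ℕ) k with hlt | heq | hlt
    · exact absurd h (hne j k hlt k.2)
    · exact Fin.ext heq
    · exact absurd h.symm (hne k j hlt j.2)
  have hint : ∀ j : Fin q, 1 < d (a j) := by
    intro j
    by_cases hj : (j : ℕ) < q - 1
    · exact (ha j hj).2.1.internal
    · have : (j : ℕ) = q - 1 := by omega
      rw [this, hlast]
      exact hTroot
  have himage : Finset.univ.image (fun j : Fin q => a j) = Finset.univ.image c := by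
    refine Finset.eq_of_subset_of_card_le ?_ ?_
    · intro v hv
      obtain ⟨j, -, rfl⟩ := Finset.mem_image.1 hv
      obtain ⟨k, hk⟩ := (hcint _).1 (hint j)
      exact Finset.mem_image.2 ⟨k, Finset.mem_univ _, hk⟩
    · rw [Finset.card_image_of_injective _ hinj, Finset.card_image_of_injective _ hcinj]
  refine ⟨q, fun j => a j, hTdeg, hinj, ?_, fun _ => hlast.symm, ?_⟩
  · intro v
    rw [hcint]
    have := Finset.ext_iff.1 himage v
    simpa using this.symm
  · intro i hi
    have hA := usedCenters_comp_val (q := q) a i.2.le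
    obtain ⟨h1, h2, h3⟩ := ha i hi
    exact (DirTree.isMinimalStar_iff hTdeg hfT h1 (hA ▸ h3)).2 (hA ▸ h2)
end
end

section
/- Suppose a directed tree T ∈ ℛ(μ,d) contains disjoint directed paths (v, m₁, …, m_k, m) and (v′, m₁′, …, m_l′, m) from vertices v, v′ ∈ V to some internal vertex m ∈ M, with 1 ≤ k ≤ l, f_T(v) < f_T(v′), and f_T(m_i) ≥ f_T(m_i′) for i = 1, …, k. If the directed tree T′ is obtained from T by deleting the arcs vm₁ and v′m₁′ and adding the arcs v′m₁ and vm₁′, then T′ ∈ ℛ(μ,d) and f(T′) strictly weakly majorizes f(T), i.e., f(T′) ≻^w f(T). -/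
open scoped Classical
noncomputable section

variable {V : Type} [Fintype V] [DecidableEq V]

namespace DirTree

lemma desc_self (T : DirTree V) (u : V) : T.Desc u u := ⟨0, rfl⟩

lemma desc_of_parent {T : DirTree V} {u x : V} (h : T.Desc (T.parent u) x) : T.Desc u x := by
  obtain ⟨n, hn⟩ := h
  exact ⟨n + 1, hn⟩

lemma desc_iff_s9 (T : DirTree V) (u x : V) : T.Desc u x ↔ u = x ∨ T.Desc (T.parent u) x := by
  refine ⟨?_, ?_⟩
  · rintro ⟨n, hn⟩
    cases n with
    | zero => exact Or.inl hn
    | succ n => exact Or.inr ⟨n, hn⟩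
  · rintro (rfl | h)
    · exact T.desc_self u
    · exact desc_of_parent h

lemma desc_root_iff (T : DirTree V) (x : V) : T.Desc T.root x ↔ x = T.root := by
  refine ⟨?_, fun h => h ▸ T.desc_self _⟩
  rintro ⟨n, hn⟩
  rw [← hn, Function.iterate_fixed T.parent_root]

lemma desc_trans {T : DirTree V} {u x y : V} (h₁ : T.Desc u x) (h₂ : T.Desc x y) :
    T.Desc u y := by
  obtain ⟨a, rfl⟩ := h₁
  obtain ⟨b, rfl⟩ := h₂
  exact ⟨b + a, Function.iterate_add_apply _ _ _ _⟩

lemma eq_root_of_iterate_eq (T : DirTree V) {u : V} {n : ℕ} (hn : 0 < n)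
    (h : T.parent^[n] u = u) : u = T.root := by
  obtain ⟨r, hr⟩ := T.reaches u
  have h₁ : T.parent^[n * r] u = u := by
    rw [Function.iterate_mul]
    exact Function.iterate_fixed h r
  have h₂ : n * r = (n * r - r) + r := (Nat.sub_add_cancel (Nat.le_mul_of_pos_left r hn)).symm
  rw [h₂, Function.iterate_add_apply, hr, Function.iterate_fixed T.parent_root] at h₁
  exact h₁.symm

lemma desc_antisymm {T : DirTree V} {u x : V} (h₁ : T.Desc u x) (h₂ : T.Desc x u) : u = x := by
  obtain ⟨a, rfl⟩ := h₁
  obtain ⟨b, hb⟩ := h₂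
  rw [← Function.iterate_add_apply] at hb
  rcases Nat.eq_zero_or_pos (b + a) with h | h
  · obtain rfl : a = 0 := by omega
    rfl
  · have hu := T.eq_root_of_iterate_eq h hb
    rw [hu, Function.iterate_fixed T.parent_root]

/-- Real-valued indicator of `T.Desc u x`. -/
def ind (T : DirTree V) (u x : V) : ℝ := if T.Desc u x then 1 else 0

lemma f_eq_sum_ind (T : DirTree V) (μ : V → ℝ) (x : V) : T.f μ x = ∑ u, μ u * T.ind u x := by
  simp [f, ind, Finset.sum_filter]

lemma ind_self (T : DirTree V) (u : V) : T.ind u u = 1 := if_pos (T.desc_self u)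

lemma ind_eq_of_parent_ne (T : DirTree V) {u : V} (hu : T.parent u ≠ u) (x : V) :
    T.ind u x = (if u = x then 1 else 0) + T.ind (T.parent u) x := by
  by_cases hux : u = x
  · subst hux
    have : ¬ T.Desc (T.parent u) u := fun h =>
      hu (desc_antisymm h (desc_of_parent (T.desc_self _)))
    simp [ind, this, T.desc_self]
  · simp [ind, T.desc_iff_s9 u x, hux]

lemma ind_root (T : DirTree V) (x : V) : T.ind T.root x = if x = T.root then 1 else 0 := by
  simp [ind, desc_root_iff]

lemma parent_ne_self_iff (T : DirTree V) (u : V) : T.parent u ≠ u ↔ u ≠ T.root := by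
  refine not_congr ⟨fun h => ?_, fun h => h ▸ T.parent_root⟩
  exact T.eq_root_of_iterate_eq one_pos h

/-- Along a path ending at `m`, the proper part of the path accounts for the descent
relation up to `m`. -/
lemma ind_path (T : DirTree V) (m x : V) (l : List V) : ∀ a : V,
    ((a :: l) ++ [m]).IsChain (fun a b => T.parent a = b) → ((a :: l) ++ [m]).Nodup →
    T.ind a x = (if x ∈ a :: l then 1 else 0) + T.ind m x := by
  induction l with
  | nil =>
    intro a hc hn
    simp at hc hn
    rw [T.ind_eq_of_parent_ne (by rw [hc]; exact fun h => hn h.symm), hc]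
    simp [eq_comm]
  | cons b l ih =>
    intro a hc hn
    simp only [List.cons_append, List.isChain_cons_cons] at hc
    have hn' := hn
    simp only [List.cons_append, List.nodup_cons] at hn'
    have hab : b ≠ a := fun h => hn'.1 (by simp [h])
    rw [T.ind_eq_of_parent_ne (by rw [hc.1]; exact hab), hc.1,
      ih b hc.2 (by simpa using hn'.2)]
    by_cases hx : x = a
    · subst hx
      have : x ∉ b :: l := fun h => hn'.1 (by
        rw [← List.cons_append]; exact List.mem_append_left _ h)
      rw [if_neg this]
      simp
    · simp [hx, Ne.symm hx]

lemma desc_of_mem_path (T : DirTree V) {m x : V} {l : List V} : ∀ {a : V},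
    ((a :: l) ++ [m]).IsChain (fun a b => T.parent a = b) → x ∈ a :: l → T.Desc x m := by
  induction l generalizing x with
  | nil =>
    intro a hc hx
    simp at hc hx
    subst hx hc
    exact desc_of_parent (T.desc_self _)
  | cons b l ih =>
    intro a hc hx
    simp only [List.cons_append, List.isChain_cons_cons] at hc
    rcases List.mem_cons.1 hx with rfl | hx
    · apply desc_of_parent
      rw [hc.1]
      exact ih hc.2 List.mem_cons_self
    · exact ih hc.2 hx

lemma ind_end_eq_zero (T : DirTree V) {m x a : V} {l : List V}
    (hc : ((a :: l) ++ [m]).IsChain fun a b => T.parent a = b)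
    (hn : ((a :: l) ++ [m]).Nodup) (hx : x ∈ a :: l) : T.ind m x = 0 := by
  refine if_neg fun h => ?_
  have := desc_antisymm h (T.desc_of_mem_path hc hx)
  subst this
  exact (List.disjoint_of_nodup_append hn) hx (by simp)

lemma parent_ne_self_of_mem_path (T : DirTree V) {m x a : V} {l : List V}
    (hc : ((a :: l) ++ [m]).IsChain fun a b => T.parent a = b)
    (hn : ((a :: l) ++ [m]).Nodup) (hx : x ∈ a :: l) : T.parent x ≠ x := by
  rw [parent_ne_self_iff]
  rintro rfl
  have h := (T.desc_root_iff m).1 (T.desc_of_mem_path hc hx)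
  subst h
  exact (List.disjoint_of_nodup_append hn) hx (by simp)

/-- Every vertex after the first one of a path has a child. -/
lemma exists_parent_eq_of_mem_path (T : DirTree V) {m x : V} {l : List V} : ∀ {a : V},
    ((a :: l) ++ [m]).IsChain (fun a b => T.parent a = b) → x ∈ l →
    ∃ u ∈ a :: l, T.parent u = x := by
  induction l with
  | nil => intro a _ hx; simp at hx
  | cons b l ih =>
    intro a hc hx
    simp only [List.cons_append, List.isChain_cons_cons] at hc
    rcases List.mem_cons.1 hx with rfl | hx
    · exact ⟨a, by simp, hc.1⟩
    · obtain ⟨u, hu, hux⟩ := ih hc.2 hx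
      exact ⟨u, List.mem_cons_of_mem _ hu, hux⟩

lemma one_lt_deg_of_mem_path (T : DirTree V) {m x a : V} {l : List V}
    (hc : ((a :: l) ++ [m]).IsChain fun a b => T.parent a = b)
    (hn : ((a :: l) ++ [m]).Nodup) (hx : x ∈ l) : 1 < T.deg x := by
  obtain ⟨u, hu, rfl⟩ := T.exists_parent_eq_of_mem_path hc hx
  have h₁ := T.parent_ne_self_of_mem_path hc hn hu
  have h₂ := T.parent_ne_self_of_mem_path hc hn (List.mem_cons_of_mem a hx)
  rw [parent_ne_self_iff] at h₂
  have : 0 < (T.children (T.parent u)).card :=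
    Finset.card_pos.2 ⟨u, by simp [children, h₁.symm]⟩
  rw [deg, if_neg h₂]
  omega

lemma card_children_s9 (T : DirTree V) (x : V) :
    (T.children x).card = ∑ u, if u ≠ T.root ∧ T.parent u = x then 1 else 0 := by
  rw [children, Finset.card_filter]
  refine Finset.sum_congr rfl fun u _ => if_congr ?_ rfl rfl
  rw [← parent_ne_self_iff]
  constructor
  · rintro ⟨rfl, h⟩
    exact ⟨h.symm, rfl⟩
  · rintro ⟨h, rfl⟩
    exact ⟨rfl, h.symm⟩

/-- Exchanging the outbound arcs of two non-root vertices preserves degrees. -/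
lemma deg_eq_of_swap {T T' : DirTree V} {v v' : V} (hroot : T'.root = T.root)
    (hv : v ≠ T.root) (hv' : v' ≠ T.root)
    (hpar : T'.parent = T.parent ∘ Equiv.swap v v') (x : V) : T'.deg x = T.deg x := by
  rw [deg, deg, card_children_s9, card_children_s9, hroot, hpar]
  congr 1
  rw [← Equiv.sum_comp (Equiv.swap v v')
    (fun u => if u ≠ T.root ∧ T.parent u = x then 1 else 0)]
  refine Finset.sum_congr rfl fun u _ => if_congr (and_congr (not_congr ?_) Iff.rfl) rfl rfl
  rw [Equiv.swap_apply_def]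
  split_ifs with h₁ h₂
  · simp [h₁, hv, hv']
  · simp [h₂, hv, hv']
  · rfl

/-- Effect on the descent relation of exchanging the outbound arcs at the start of two
disjoint paths with a common end. -/
lemma ind_swap {T T' : DirTree V} {v v' m m₁ m₁' : V} {rest rest' : List V}
    (hpath : ((v :: m₁ :: rest) ++ [m]).IsChain fun a b => T.parent a = b)
    (hnodup : ((v :: m₁ :: rest) ++ [m]).Nodup)
    (hpath' : ((v' :: m₁' :: rest') ++ [m]).IsChain fun a b => T.parent a = b)
    (hnodup' : ((v' :: m₁' :: rest') ++ [m]).Nodup)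
    (hdisj : (v :: m₁ :: rest).Disjoint (v' :: m₁' :: rest'))
    (hroot : T'.root = T.root)
    (hpar : T'.parent = T.parent ∘ Equiv.swap v v') (u x : V) :
    T'.ind u x = T.ind u x + (T.ind u v' - T.ind u v) *
      ((if x ∈ m₁ :: rest then 1 else 0) - (if x ∈ m₁' :: rest' then 1 else 0)) := by
  have hv : v ≠ T.root := (T.parent_ne_self_iff v).1
    (T.parent_ne_self_of_mem_path hpath hnodup (by simp))
  have hv' : v' ≠ T.root := (T.parent_ne_self_iff v').1
    (T.parent_ne_self_of_mem_path hpath' hnodup' (by simp))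
  have hvv' : v ≠ v' := fun h => hdisj (a := v) (by simp) (by simp [h])
  have hpv : T.parent v = m₁ := by
    simp only [List.cons_append, List.isChain_cons_cons] at hpath; exact hpath.1
  have hpv' : T.parent v' = m₁' := by
    simp only [List.cons_append, List.isChain_cons_cons] at hpath'; exact hpath'.1
  have hc : ((m₁ :: rest) ++ [m]).IsChain fun a b => T.parent a = b := by
    simp only [List.cons_append, List.isChain_cons_cons] at hpath; exact hpath.2
  have hc' : ((m₁' :: rest') ++ [m]).IsChain fun a b => T.parent a = b := by
    simp only [List.cons_append, List.isChain_cons_cons] at hpath'; exact hpath'.2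
  have hn : ((m₁ :: rest) ++ [m]).Nodup := (List.nodup_cons.1 hnodup).2
  have hn' : ((m₁' :: rest') ++ [m]).Nodup := (List.nodup_cons.1 hnodup').2
  have hmv : T.ind m v = 0 := T.ind_end_eq_zero hpath hnodup (by simp)
  have hmv' : T.ind m v' = 0 := T.ind_end_eq_zero hpath' hnodup' (by simp)
  have hvP : v ∉ m₁ :: rest := fun h =>
    (List.nodup_cons.1 hnodup).1 (List.mem_append_left _ h)
  have hvP' : v ∉ m₁' :: rest' := fun h => hdisj (a := v) (by simp) (List.mem_cons_of_mem _ h)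
  have hv'P : v' ∉ m₁ :: rest := fun h => hdisj (a := v') (List.mem_cons_of_mem _ h) (by simp)
  have hv'P' : v' ∉ m₁' :: rest' := fun h =>
    (List.nodup_cons.1 hnodup').1 (List.mem_append_left _ h)
  have e₁ := fun y => T.ind_path m y rest m₁ hc hn
  have e₂ := fun y => T.ind_path m y rest' m₁' hc' hn'
  have hm₁v : T.ind m₁ v = 0 := by rw [e₁, if_neg hvP, hmv, add_zero]
  have hm₁v' : T.ind m₁ v' = 0 := by rw [e₁, if_neg hv'P, hmv', add_zero]
  have hm₁'v : T.ind m₁' v = 0 := by rw [e₂, if_neg hvP', hmv, add_zero]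
  have hm₁'v' : T.ind m₁' v' = 0 := by rw [e₂, if_neg hv'P', hmv', add_zero]
  have hvv'0 : T.ind v v' = 0 := by
    rw [T.ind_eq_of_parent_ne ((T.parent_ne_self_iff v).2 hv), if_neg hvv', hpv, hm₁v', add_zero]
  have hv'v0 : T.ind v' v = 0 := by
    rw [T.ind_eq_of_parent_ne ((T.parent_ne_self_iff v').2 hv'), if_neg hvv'.symm, hpv', hm₁'v,
      add_zero]
  obtain ⟨n, hreach⟩ := T'.reaches u
  induction n generalizing u with
  | zero =>
    have hu : u = T'.root := hreach
    subst hu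
    rw [T'.ind_root, hroot, T.ind_root, T.ind_root, T.ind_root, if_neg hv, if_neg hv']
    ring
  | succ n ih =>
    specialize ih (T'.parent u) hreach
    by_cases hu : u = T'.root
    · subst hu
      rwa [T'.parent_root] at ih
    have huT : u ≠ T.root := hroot ▸ hu
    rw [T'.ind_eq_of_parent_ne ((T'.parent_ne_self_iff u).2 hu), ih,
      T.ind_eq_of_parent_ne ((T.parent_ne_self_iff u).2 huT) x]
    by_cases h₁ : u = v
    · subst h₁
      have : T'.parent u = m₁' := by simp [hpar, hpv']
      rw [this, hpv, hm₁'v', hm₁'v, hvv'0, T.ind_self, e₁ x, e₂ x]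
      ring
    by_cases h₂ : u = v'
    · subst h₂
      have : T'.parent u = m₁ := by simp [hpar, hpv]
      rw [this, hpv', hm₁v', hm₁v, hv'v0, T.ind_self, e₁ x, e₂ x]
      ring
    have : T'.parent u = T.parent u := by
      simp [hpar, Equiv.swap_apply_of_ne_of_ne h₁ h₂]
    rw [this, T.ind_eq_of_parent_ne ((T.parent_ne_self_iff u).2 huT) v,
      T.ind_eq_of_parent_ne ((T.parent_ne_self_iff u).2 huT) v', if_neg h₁, if_neg h₂]
    ring

end DirTree

lemma mul_sub_sum_posPart_le_sum_take (t : ℝ) (l : List ℝ) : ∀ k ≤ l.length,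
    k * t - (l.map fun y => max (t - y) 0).sum ≤ (l.take k).sum := by
  induction l with
  | nil => intro k hk; simp at hk; simp [hk]
  | cons a l ih =>
    intro k hk
    cases k with
    | zero =>
      have h := ih 0 (Nat.zero_le _)
      simp at h ⊢
      exact Or.inr h
    | succ k =>
      have h := ih k (by simpa using hk)
      have := le_max_left (t - a) 0
      simp only [List.map_cons, List.sum_cons, List.take_succ_cons]
      push_cast
      linarith

lemma exists_sum_take_eq (l : List ℝ) (hl : l.Pairwise (· ≤ ·)) (k : ℕ) (hk : k < l.length) :
    ∃ t : ℝ, (l.take (k + 1)).sum =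
      ((k + 1 : ℕ) : ℝ) * t - (l.map fun y => max (t - y) 0).sum := by
  refine ⟨l[k], ?_⟩
  have h₁ : ((l.take (k + 1)).map fun y => max (l[k] - y) 0) =
      (l.take (k + 1)).map fun y => l[k] - y := by
    refine List.map_congr_left fun y hy => max_eq_left (sub_nonneg.2 ?_)
    obtain ⟨i, hi, rfl⟩ := List.mem_iff_getElem.1 hy
    rw [List.length_take] at hi
    rw [List.getElem_take]
    rcases Nat.lt_or_ge i k with h | h
    · exact List.pairwise_iff_getElem.1 hl i k (by omega) hk h
    · obtain rfl : i = k := by omega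
      rfl
  have h₂ : ((l.drop (k + 1)).map fun y => max (l[k] - y) 0) =
      (l.drop (k + 1)).map fun _ => (0 : ℝ) := by
    refine List.map_congr_left fun y hy => max_eq_right (sub_nonpos.2 ?_)
    obtain ⟨i, hi, rfl⟩ := List.mem_iff_getElem.1 hy
    rw [List.length_drop] at hi
    rw [List.getElem_drop]
    exact List.pairwise_iff_getElem.1 hl k (k + 1 + i) hk (by omega) (by omega)
  have h₃ : ∀ (s : List ℝ) (t : ℝ), (s.map fun y => t - y).sum = s.length * t - s.sum := by
    intro s t
    induction s with
    | nil => simp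
    | cons a s ih => simp [ih]; ring
  have hlen : (l.take (k + 1)).length = k + 1 := by rw [List.length_take]; omega
  rw [show (l.map fun y => max (l[k] - y) 0).sum =
    ((l.take (k + 1)).map fun y => max (l[k] - y) 0).sum +
      ((l.drop (k + 1)).map fun y => max (l[k] - y) 0).sum by
    rw [← List.sum_append, ← List.map_append, List.take_append_drop], h₁, h₂, h₃, hlen]
  simp

lemma wmaj_of_sum_posPart_le {x y : Multiset ℝ} (hcard : Multiset.card x = Multiset.card y)
    (h : ∀ t : ℝ, (y.map fun a => max (t - a) 0).sum ≤ (x.map fun a => max (t - a) 0).sum) :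
    WMaj x y := by
  have key : ∀ k ≤ Multiset.card x, ascSum x k ≤ ascSum y k := by
    intro k hk
    cases k with
    | zero => simp [ascSum]
    | succ k =>
      obtain ⟨t, ht⟩ := exists_sum_take_eq (x.sort (· ≤ ·)) (Multiset.pairwise_sort x _) k
        (by rw [Multiset.length_sort]; omega)
      have hy := mul_sub_sum_posPart_le_sum_take t (y.sort (· ≤ ·)) (k + 1)
        (by rw [Multiset.length_sort]; omega)
      have hs : ∀ z : Multiset ℝ, ((z.sort (· ≤ ·)).map fun a => max (t - a) 0).sum =
          (z.map fun a => max (t - a) 0).sum := by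
        intro z
        conv_rhs => rw [← Multiset.sort_eq z (· ≤ ·)]
        rw [Multiset.map_coe, Multiset.sum_coe]
      rw [hs] at ht hy
      rw [ascSum, ascSum, ht]
      linarith [h t]
  refine ⟨hcard, fun k => ?_⟩
  rcases le_total k (Multiset.card x) with hk | hk
  · exact key k hk
  · have hx : ascSum x k = ascSum x (Multiset.card x) := by
      rw [ascSum, ascSum, List.take_of_length_le (by simpa using hk),
        List.take_of_length_le (by simp)]
    have hy : ascSum y k = ascSum y (Multiset.card x) := by
      rw [ascSum, ascSum, List.take_of_length_le (by rw [Multiset.length_sort]; omega),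
        List.take_of_length_le (by simp [hcard])]
    rw [hx, hy]
    exact key _ le_rfl

lemma posPart_sub_add_le {t a b δ : ℝ} (hδ : 0 ≤ δ) (hab : b ≤ a) :
    0 ≤ (max (t - (a + δ)) 0 - max (t - a) 0) + (max (t - (b - δ)) 0 - max (t - b) 0) := by
  rcases max_cases (t - (a + δ)) 0 with h₁ | h₁ <;> rcases max_cases (t - a) 0 with h₂ | h₂ <;>
  rcases max_cases (t - (b - δ)) 0 with h₃ | h₃ <;> rcases max_cases (t - b) 0 with h₄ | h₄ <;>
  linarith

/-- Spreading apart dominated pairs, and decreasing the unpaired values, does not decrease the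
sum of positive parts. -/
lemma sum_posPart_paired_nonneg {α : Type*} (g : α → ℝ) {t δ : ℝ} (hδ : 0 ≤ δ) :
    ∀ (A B : List α) (hlen : A.length ≤ B.length)
      (_ : ∀ (i : ℕ) (hi : i < A.length), g (B.get ⟨i, hi.trans_le hlen⟩) ≤ g (A.get ⟨i, hi⟩)),
      0 ≤ (A.map fun a => max (t - (g a + δ)) 0 - max (t - g a) 0).sum +
        (B.map fun b => max (t - (g b - δ)) 0 - max (t - g b) 0).sum
  | [], B, _, _ => by
    simp only [List.map_nil, List.sum_nil, zero_add]
    refine List.sum_nonneg fun y hy => ?_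
    obtain ⟨b, -, rfl⟩ := List.mem_map.1 hy
    exact sub_nonneg.2 (max_le_max (by linarith) le_rfl)
  | a :: A, [], hlen, _ => by simp at hlen
  | a :: A, b :: B, hlen, h => by
    have ih := sum_posPart_paired_nonneg g (t := t) hδ A B (by simpa using hlen) fun i hi => by
      simpa using h (i + 1) (by simpa using hi)
    have h₀ : g b ≤ g a := by simpa using h 0 (by simp)
    have := posPart_sub_add_le (t := t) hδ h₀
    simp only [List.map_cons, List.sum_cons]
    linarith

lemma sum_posPart_paired_pos {α : Type*} (g : α → ℝ) {δ : ℝ} (hδ : 0 < δ) (a b : α)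
    (A B : List α) (hlen : (a :: A).length ≤ (b :: B).length)
    (h : ∀ (i : ℕ) (hi : i < (a :: A).length),
      g ((b :: B).get ⟨i, hi.trans_le hlen⟩) ≤ g ((a :: A).get ⟨i, hi⟩)) :
    0 < ((a :: A).map fun a => max (g b - (g a + δ)) 0 - max (g b - g a) 0).sum +
      ((b :: B).map fun c => max (g b - (g c - δ)) 0 - max (g b - g c) 0).sum := by
  have ht := sum_posPart_paired_nonneg g (t := g b) hδ.le A B (by simpa using hlen)
    fun i hi => by simpa using h (i + 1) (by simpa using hi)
  have h₀ : g b ≤ g a := by simpa using h 0 (by simp)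
  simp only [List.map_cons, List.sum_cons]
  rw [max_eq_right (show g b - (g a + δ) ≤ 0 by linarith),
    max_eq_right (show g b - g a ≤ 0 by linarith),
    max_eq_left (show 0 ≤ g b - (g b - δ) by linarith), sub_self (g b), max_self]
  linarith

/-- A sum of differences supported on two disjoint lists. -/
lemma sum_shift_eq {α : Type*} [DecidableEq α] {s : Finset α} {A B : List α} {g g' : α → ℝ}
    {δ : ℝ} (φ : ℝ → ℝ) (hA : A.Nodup) (hB : B.Nodup) (hAB : A.Disjoint B)
    (hAs : ∀ a ∈ A, a ∈ s) (hBs : ∀ b ∈ B, b ∈ s)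
    (hg : ∀ x, g' x = g x + δ * ((if x ∈ A then 1 else 0) - (if x ∈ B then 1 else 0))) :
    ∑ x ∈ s, φ (g' x) - ∑ x ∈ s, φ (g x) =
      (A.map fun a => φ (g a + δ) - φ (g a)).sum + (B.map fun b => φ (g b - δ) - φ (g b)).sum := by
  have hdis : Disjoint A.toFinset B.toFinset := by
    rw [Finset.disjoint_left]
    intro x hx hx'
    exact hAB (List.mem_toFinset.1 hx) (List.mem_toFinset.1 hx')
  rw [← Finset.sum_sub_distrib, ← Finset.sum_subset (s₁ := A.toFinset ∪ B.toFinset),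
    Finset.sum_union hdis, ← List.sum_toFinset _ hA, ← List.sum_toFinset _ hB]
  · congr 1
    · refine Finset.sum_congr rfl fun x hx => ?_
      have hx := List.mem_toFinset.1 hx
      rw [hg, if_pos hx, if_neg (fun h => hAB hx h)]
      ring_nf
    · refine Finset.sum_congr rfl fun x hx => ?_
      have hx := List.mem_toFinset.1 hx
      rw [hg, if_pos hx, if_neg (fun h => hAB h hx)]
      ring_nf
  · intro x hx
    rcases Finset.mem_union.1 hx with h | h
    · exact hAs x (List.mem_toFinset.1 h)
    · exact hBs x (List.mem_toFinset.1 h)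
  · intro x _ hx
    simp only [Finset.mem_union, List.mem_toFinset, not_or] at hx
    rw [hg, if_neg hx.1, if_neg hx.2]
    simp

/-- swapping the outbound arcs of `v` and `v'` at the bottom of two disjoint
paths `(v, m₁, …, m_k, m)` and `(v', m₁', …, m_l', m)` with `1 ≤ k ≤ l`,
`f_T(v) < f_T(v')` and `f_T(m_i) ≥ f_T(m_i')` yields a tree of `ℛ(μ,d)` whose vector of
subordinate groups' weights strictly weakly majorizes that of `T`. -/
theorem exchange_lemma_one {V : Type} [Fintype V] [DecidableEq V]
    (μ : V → ℝ) (d : V → ℕ) (hgen : IsGenTuple μ d)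
    (T : DirTree V) (hT : memR T d)
    (v v' m m₁ m₁' : V) (rest rest' : List V) (hm : 1 < d m)
    (hpath : ((v :: m₁ :: rest) ++ [m]).Chain' fun a b => T.parent a = b)
    (hnodup : ((v :: m₁ :: rest) ++ [m]).Nodup)
    (hpath' : ((v' :: m₁' :: rest') ++ [m]).Chain' fun a b => T.parent a = b)
    (hnodup' : ((v' :: m₁' :: rest') ++ [m]).Nodup)
    (hdisj : (v :: m₁ :: rest).Disjoint (v' :: m₁' :: rest'))
    (hkl : (m₁ :: rest).length ≤ (m₁' :: rest').length)
    (hf : T.f μ v < T.f μ v')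
    (hmaj : ∀ i : ℕ, ∀ hi : i < (m₁ :: rest).length,
      T.f μ ((m₁' :: rest').get ⟨i, lt_of_lt_of_le hi hkl⟩) ≤
        T.f μ ((m₁ :: rest).get ⟨i, hi⟩))
    (T' : DirTree V) (hroot : T'.root = T.root)
    (hpar : T'.parent = Function.update (Function.update T.parent v m₁') v' m₁) :
    memR T' d ∧ SWMaj (T'.fvec μ) (T.fvec μ) := by
  have hv : v ≠ T.root := (T.parent_ne_self_iff v).1
    (T.parent_ne_self_of_mem_path hpath hnodup (by simp))
  have hv' : v' ≠ T.root := (T.parent_ne_self_iff v').1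
    (T.parent_ne_self_of_mem_path hpath' hnodup' (by simp))
  have hpv : T.parent v = m₁ := (List.isChain_cons_cons.1 hpath).1
  have hpv' : T.parent v' = m₁' := (List.isChain_cons_cons.1 hpath').1
  have hswap : T'.parent = T.parent ∘ Equiv.swap v v' := by
    funext u
    rw [hpar, Function.comp_apply, Equiv.swap_apply_def, Function.update_apply,
      Function.update_apply]
    by_cases h₁ : u = v' <;> by_cases h₂ : u = v
    · exact absurd (by simp [← h₁, h₂]) (hdisj (a := v) (by simp))
    · rw [if_pos h₁, if_neg h₂, if_pos h₁, hpv]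
    · rw [if_neg h₁, if_pos h₂, if_pos h₂, hpv']
    · rw [if_neg h₁, if_neg h₂, if_neg h₂, if_neg h₁]
  have hdeg : ∀ x, T'.deg x = T.deg x := DirTree.deg_eq_of_swap hroot hv hv' hswap
  refine ⟨⟨hroot ▸ hT.1, fun x => (hdeg x).trans (hT.2 x)⟩, ?_⟩
  set s := Finset.univ.filter fun x => 1 < T.deg x ∧ x ≠ T.root with hs
  have hvec : T.fvec μ = s.val.map (T.f μ) := rfl
  have hvec' : T'.fvec μ = s.val.map (T'.f μ) := by
    simp only [DirTree.fvec, hdeg, hroot, hs]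
  set δ := T.f μ v' - T.f μ v with hδ
  have hδ₀ : 0 < δ := sub_pos.2 hf
  have hshift : ∀ x, T'.f μ x = T.f μ x + δ *
      ((if x ∈ m₁ :: rest then 1 else 0) - (if x ∈ m₁' :: rest' then 1 else 0)) := by
    intro x
    rw [hδ]
    simp only [DirTree.f_eq_sum_ind]
    rw [← Finset.sum_sub_distrib, Finset.sum_mul, ← Finset.sum_add_distrib]
    refine Finset.sum_congr rfl fun u _ => ?_
    rw [DirTree.ind_swap hpath hnodup hpath' hnodup' hdisj hroot hswap]
    ring
  have hAs : ∀ a ∈ m₁ :: rest, a ∈ s := fun a ha => by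
    rw [hs, Finset.mem_filter]
    exact ⟨Finset.mem_univ _, T.one_lt_deg_of_mem_path hpath hnodup ha,
      (T.parent_ne_self_iff a).1
        (T.parent_ne_self_of_mem_path hpath hnodup (List.mem_cons_of_mem _ ha))⟩
  have hBs : ∀ a ∈ m₁' :: rest', a ∈ s := fun a ha => by
    rw [hs, Finset.mem_filter]
    exact ⟨Finset.mem_univ _, T.one_lt_deg_of_mem_path hpath' hnodup' ha,
      (T.parent_ne_self_iff a).1
        (T.parent_ne_self_of_mem_path hpath' hnodup' (List.mem_cons_of_mem _ ha))⟩
  have hdiff := fun t : ℝ => sum_shift_eq (fun y => max (t - y) 0)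
    (List.nodup_cons.1 (List.nodup_append.1 hnodup).1).2
    (List.nodup_cons.1 (List.nodup_append.1 hnodup').1).2
    (fun x hx hx' => hdisj (List.mem_cons_of_mem _ hx) (List.mem_cons_of_mem _ hx'))
    hAs hBs hshift
  have hmap : ∀ (g : V → ℝ) (t : ℝ), ((s.val.map g).map fun y => max (t - y) 0).sum =
      ∑ x ∈ s, max (t - g x) 0 := fun g t => by
    rw [Multiset.map_map]
    rfl
  rw [hvec, hvec']
  refine ⟨wmaj_of_sum_posPart_le (by simp) fun t => ?_, fun heq => ?_⟩
  · rw [hmap, hmap, ← sub_nonneg, hdiff t]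
    exact sum_posPart_paired_nonneg (T.f μ) hδ₀.le _ _ hkl hmaj
  · have hpos := sum_posPart_paired_pos (T.f μ) hδ₀ m₁ m₁' rest rest' hkl hmaj
    rw [← hdiff (T.f μ m₁'), ← hmap, ← hmap, heq, sub_self] at hpos
    exact hpos.false
end
end
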